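/- There exist an integer N ≥ N₀+1, a symmetric positive definite matrix P ∈ ℝ^{(2N+1)×(2N+1)}, and reals ε ∈ (0,1/2], α > 1, β > 0, γ > 0 such that the block matrix Θ₁ = [[FᵀP + PF + 2δP + αγG, Pℒ],[ℒᵀP, −β]] is negative semidefinite, Θ₂ := 2γ(−(1−1/α)λ_{N+1} + q_c + δ) + βM₂(ε)λ_{N+1}^{1/2+ε} ≤ 0, and Θ₃ := 2γ(1−1/α) − βM₂(ε)/λ_{N+1}^{1/2−ε} ≥ 0. (Feasibility of the LMI constraints of Theorem 3, Neumann boundary measurement case.) -/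

import Mathlib

open Matrix

noncomputable section

/-- Negative semidefiniteness of a real matrix. -/
def Matrix.NegSemidef {ι : Type*} [Fintype ι] (M : Matrix ι ι ℝ) : Prop :=
  (-M).PosSemidef

/-- All eigenvalues of the complexification of `M` have real part `< r`. -/
def specLt {ι : Type*} [Fintype ι] [DecidableEq ι] (M : Matrix ι ι ℝ) (r : ℝ) : Prop :=
  ∀ μ : ℂ, (M.map (Complex.ofReal ·)).charpoly.IsRoot μ → μ.re < r

/-- `A₀ = diag(-λ₁ + q_c, …, -λ_{N₀} + q_c)`. -/
def A0 (N₀ : ℕ) (lam : ℕ → ℝ) (qc : ℝ) : Matrix (Fin N₀) (Fin N₀) ℝ :=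
  Matrix.diagonal fun i => -lam (i.1 + 1) + qc

/-- Column vector `(f 1, …, f N₀)ᵀ` (e.g. `B₀ₐ`, `B₀ᵦ`). -/
def colVec (N₀ : ℕ) (f : ℕ → ℝ) : Matrix (Fin N₀) (Fin 1) ℝ :=
  Matrix.of fun i _ => f (i.1 + 1)

/-- `A₁ = [[0, 0], [B₀ₐ, A₀]]`. -/
def A1 (N₀ : ℕ) (lam : ℕ → ℝ) (qc : ℝ) (a : ℕ → ℝ) :
    Matrix (Fin 1 ⊕ Fin N₀) (Fin 1 ⊕ Fin N₀) ℝ :=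
  Matrix.fromBlocks 0 0 (colVec N₀ a) (A0 N₀ lam qc)

/-- `B₁ = (1, b₁, …, b_{N₀})ᵀ`. -/
def B1 (N₀ : ℕ) (b : ℕ → ℝ) : Matrix (Fin 1 ⊕ Fin N₀) (Fin 1) ℝ :=
  Matrix.of (Sum.elim (fun _ _ => 1) (fun i _ => b (i.1 + 1)))

/-- Row `C₀ = (f 1, …, f N₀)`. -/
def C0 (N₀ : ℕ) (f : ℕ → ℝ) : Matrix (Fin 1) (Fin N₀) ℝ :=
  Matrix.of fun _ j => f (j.1 + 1)

/-- `A₂ = diag(-λ_{N₀+1} + q_c, …, -λ_N + q_c)`. -/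
def A2 (N₀ N : ℕ) (lam : ℕ → ℝ) (qc : ℝ) :
    Matrix (Fin (N - N₀)) (Fin (N - N₀)) ℝ :=
  Matrix.diagonal fun i => -lam (N₀ + 1 + i.1) + qc

/-- Column vector `(f (N₀+1), …, f N)ᵀ` (e.g. `B₂ₐ`, `B₂ᵦ`). -/
def colVec2 (N₀ N : ℕ) (f : ℕ → ℝ) : Matrix (Fin (N - N₀)) (Fin 1) ℝ :=
  Matrix.of fun i _ => f (N₀ + 1 + i.1)

/-- Scaled row `C₁ = (y_{N₀+1}/λ_{N₀+1}, …, y_N/λ_N)` (Neumann measurement case). -/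
def C1 (N₀ N : ℕ) (lam y : ℕ → ℝ) : Matrix (Fin 1) (Fin (N - N₀)) ℝ :=
  Matrix.of fun _ j => y (N₀ + 1 + j.1) / lam (N₀ + 1 + j.1)

/-- `L̃ = (0, Lᵀ)ᵀ`. -/
def Ltil (N₀ : ℕ) (L : Matrix (Fin N₀) (Fin 1) ℝ) :
    Matrix (Fin 1 ⊕ Fin N₀) (Fin 1) ℝ :=
  Matrix.of (Sum.elim (fun _ _ => 0) (fun i j => L i j))

/-- `[B₂ₐ 0]`. -/
def B2a0 (N₀ N : ℕ) (a : ℕ → ℝ) : Matrix (Fin (N - N₀)) (Fin 1 ⊕ Fin N₀) ℝ :=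
  Matrix.of fun i => Sum.elim (fun _ => a (N₀ + 1 + i.1)) (fun _ => 0)

/-- Closed-loop state index (total cardinality `2N+1` when `N₀ ≤ N`). -/
abbrev ιF (N₀ N : ℕ) := ((Fin 1 ⊕ Fin N₀) ⊕ Fin N₀) ⊕ (Fin (N - N₀) ⊕ Fin (N - N₀))

/-- The closed-loop matrix `F` of (23), parametrized by the rows `C₀` and `C₁`. -/
def Fmat (N₀ N : ℕ) (lam a b : ℕ → ℝ) (qc : ℝ)
    (K : Matrix (Fin 1) (Fin 1 ⊕ Fin N₀) ℝ) (L : Matrix (Fin N₀) (Fin 1) ℝ)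
    (C0m : Matrix (Fin 1) (Fin N₀) ℝ) (C1m : Matrix (Fin 1) (Fin (N - N₀)) ℝ) :
    Matrix (ιF N₀ N) (ιF N₀ N) ℝ :=
  Matrix.fromBlocks
    (Matrix.fromBlocks (A1 N₀ lam qc a + B1 N₀ b * K) (Ltil N₀ L * C0m)
      0 (A0 N₀ lam qc - L * C0m))
    (Matrix.fromBlocks 0 (Ltil N₀ L * C1m) 0 (-(L * C1m)))
    (Matrix.fromBlocks (colVec2 N₀ N b * K + B2a0 N₀ N a) 0 0 0)
    (Matrix.fromBlocks (A2 N₀ N lam qc) 0 0 (A2 N₀ N lam qc))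

/-- `ℒ = col(L̃, -L, 0, 0)`. -/
def Lcal (N₀ N : ℕ) (L : Matrix (Fin N₀) (Fin 1) ℝ) : Matrix (ιF N₀ N) (Fin 1) ℝ :=
  Matrix.of
    (Sum.elim (Sum.elim (fun i j => Ltil N₀ L i j) (fun i j => -L i j)) fun _ _ => 0)

/-- `E = (1, 0, …, 0)`. -/
def Erow (N₀ N : ℕ) : Matrix (Fin 1) (ιF N₀ N) ℝ :=
  Matrix.of fun _ =>
    Sum.elim (Sum.elim (Sum.elim (fun _ => 1) fun _ => 0) fun _ => 0) fun _ => 0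

/-- `K̃ = (K, 0, 0, 0)`. -/
def Ktil (N₀ N : ℕ) (K : Matrix (Fin 1) (Fin 1 ⊕ Fin N₀) ℝ) :
    Matrix (Fin 1) (ιF N₀ N) ℝ :=
  Matrix.of fun r => Sum.elim (Sum.elim (fun j => K r j) fun _ => 0) fun _ => 0

/-- `G = ‖a‖² EᵀE + ‖b‖² K̃ᵀK̃`. -/
def Gmat (N₀ N : ℕ) (na2 nb2 : ℝ) (K : Matrix (Fin 1) (Fin 1 ⊕ Fin N₀) ℝ) :
    Matrix (ιF N₀ N) (ιF N₀ N) ℝ :=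
  na2 • ((Erow N₀ N)ᵀ * Erow N₀ N) + nb2 • ((Ktil N₀ N K)ᵀ * Ktil N₀ N K)

section Helpers

open scoped Matrix.Norms.L2Operator in
lemma aux_gelfand {n : Type*} [Fintype n] [DecidableEq n] [Nonempty n] (M : Matrix n n ℂ)
    (h : ∀ μ : ℂ, M.charpoly.IsRoot μ → ‖μ‖ < 1) : ∃ k : ℕ, ‖M ^ k‖ ≤ 1 / 2 := by
  have h1 : spectralRadius ℂ M < ((1 : NNReal) : ENNReal) := by
    apply spectrum.spectralRadius_lt_of_forall_lt
    intro z hz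
    have := h z (Matrix.mem_spectrum_iff_isRoot_charpoly.mp hz)
    exact_mod_cast this
  obtain ⟨r, hr1, hr2⟩ := ENNReal.lt_iff_exists_nnreal_btwn.mp h1
  have hr2' : r < 1 := by exact_mod_cast hr2
  have ht := spectrum.pow_nnnorm_pow_one_div_tendsto_nhds_spectralRadius M
  have he := ht.eventually (gt_mem_nhds hr1)
  have hp : Filter.Tendsto (fun k : ℕ => (r : ℝ) ^ k) Filter.atTop (nhds 0) :=
    tendsto_pow_atTop_nhds_zero_of_lt_one r.2 (by exact_mod_cast hr2')
  have hp' := hp.eventually (gt_mem_nhds (show (0 : ℝ) < 1 / 2 by norm_num))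
  obtain ⟨k, hk1, hk2, hk3⟩ := (he.and (hp'.and (Filter.eventually_ge_atTop 1))).exists
  refine ⟨k, le_trans ?_ hk2.le⟩
  have hk0 : (k : ℝ) ≠ 0 := by positivity
  have h3 : ((‖M ^ k‖₊ : ENNReal)) < (r : ENNReal) ^ k := by
    have := ENNReal.rpow_lt_rpow hk1 (show (0 : ℝ) < k by positivity)
    rw [← ENNReal.rpow_mul, one_div, inv_mul_cancel₀ hk0, ENNReal.rpow_one,
      ENNReal.rpow_natCast] at this
    exact this
  have h4 : ‖M ^ k‖₊ < r ^ k := by exact_mod_cast h3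
  exact_mod_cast h4.le

open scoped Matrix.Norms.L2Operator in
lemma aux_real_bound {n : Type*} [Fintype n] [DecidableEq n] (M : Matrix n n ℝ)
    (h : ‖M.map (Complex.ofReal ·)‖ ≤ 1 / 2) (x : n → ℝ) :
    4 * ((M *ᵥ x) ⬝ᵥ (M *ᵥ x)) ≤ x ⬝ᵥ x := by
  have h1 := Matrix.l2_opNorm_mulVec (M.map (Complex.ofReal ·))
    (WithLp.toLp 2 (fun i => (x i : ℂ)))
  have hx : ‖(WithLp.toLp 2 (fun i => (x i : ℂ)) : EuclideanSpace ℂ n)‖ ^ 2 = x ⬝ᵥ x := by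
    rw [EuclideanSpace.norm_sq_eq]
    simp [dotProduct, sq]
  have hM : ‖(EuclideanSpace.equiv n ℂ).symm
      (M.map (Complex.ofReal ·) *ᵥ (fun i => (x i : ℂ)))‖ ^ 2 = (M *ᵥ x) ⬝ᵥ (M *ᵥ x) := by
    have : (M.map (Complex.ofReal ·) *ᵥ (fun i => (x i : ℂ))) = fun i => ((M *ᵥ x) i : ℂ) := by
      ext i
      simp [mulVec, dotProduct]
    rw [EuclideanSpace.norm_sq_eq, this]
    simp [dotProduct, sq]
  rw [← hx, ← hM]
  have h2 : ‖(EuclideanSpace.equiv n ℂ).symm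
      (M.map (Complex.ofReal ·) *ᵥ (fun i => (x i : ℂ)))‖ ≤
      1 / 2 * ‖(WithLp.toLp 2 (fun i => (x i : ℂ)) : EuclideanSpace ℂ n)‖ :=
    h1.trans (mul_le_mul_of_nonneg_right h (norm_nonneg _))
  have h3 := norm_nonneg ((EuclideanSpace.equiv n ℂ).symm
      (M.map (Complex.ofReal ·) *ᵥ (fun i => (x i : ℂ))))
  nlinarith

lemma aux_bound {m n : Type*} [Fintype m] [Fintype n] (M : Matrix m n ℝ) :
    ∃ c : ℝ, 0 ≤ c ∧ ∀ x : n → ℝ, (M *ᵥ x) ⬝ᵥ (M *ᵥ x) ≤ c * (x ⬝ᵥ x) := by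
  refine ⟨∑ i, ∑ j, M i j ^ 2, by positivity, fun x => ?_⟩
  rw [Finset.sum_mul]
  simp only [dotProduct, mulVec]
  refine Finset.sum_le_sum fun i _ => ?_
  have := Finset.sum_mul_sq_le_sq_mul_sq Finset.univ (fun j => M i j) x
  simpa only [sq] using this

lemma aux_dot_nonneg {n : Type*} [Fintype n] (x : n → ℝ) : 0 ≤ x ⬝ᵥ x :=
  Finset.sum_nonneg fun i _ => mul_self_nonneg (x i)

lemma aux_dot_pos {n : Type*} [Fintype n] (x : n → ℝ) (hx : x ≠ 0) : 0 < x ⬝ᵥ x :=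
  lt_of_le_of_ne (aux_dot_nonneg x) fun h => hx (dotProduct_self_eq_zero.mp h.symm)

lemma aux_young {n : Type*} [Fintype n] (x y : n → ℝ) (e : ℝ) (he : 0 < e) :
    2 * (x ⬝ᵥ y) ≤ e * (x ⬝ᵥ x) + e⁻¹ * (y ⬝ᵥ y) := by
  have h := aux_dot_nonneg (e • x - y)
  simp only [sub_dotProduct, dotProduct_sub, smul_dotProduct, dotProduct_smul, smul_eq_mul] at h
  rw [dotProduct_comm y x] at h
  have h2 : 0 ≤ e⁻¹ * (e * (e * x ⬝ᵥ x - x ⬝ᵥ y) - (e * x ⬝ᵥ y - y ⬝ᵥ y)) :=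
    mul_nonneg (by positivity) h
  have h3 : e⁻¹ * (e * (e * x ⬝ᵥ x - x ⬝ᵥ y) - (e * x ⬝ᵥ y - y ⬝ᵥ y))
    = e * (x ⬝ᵥ x) + e⁻¹ * (y ⬝ᵥ y) - 2 * (x ⬝ᵥ y) := by
    field_simp
    ring
  linarith

lemma aux_cayley {n : Type*} [Fintype n] [DecidableEq n] [Nonempty n] (S : Matrix n n ℝ)
    (hS : ∀ μ : ℂ, (S.map (Complex.ofReal ·)).charpoly.IsRoot μ → μ.re < 0) :
    IsUnit (S - 1).det ∧ ∃ k : ℕ, ∀ x : n → ℝ,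
      4 * ((((S + 1) * (S - 1)⁻¹) ^ k *ᵥ x) ⬝ᵥ (((S + 1) * (S - 1)⁻¹) ^ k *ᵥ x)) ≤ x ⬝ᵥ x := by
  have hmap : ∀ M : Matrix n n ℝ, M.map (Complex.ofReal ·) = Complex.ofRealHom.mapMatrix M :=
    fun M => rfl
  have hu : IsUnit (S - 1).det := by
    rw [isUnit_iff_ne_zero]
    intro h0
    have h1 : (S.map (Complex.ofReal ·)).charpoly.IsRoot 1 := by
      rw [Polynomial.IsRoot.def, Matrix.eval_charpoly, hmap]
      have : (Matrix.scalar n) (1 : ℂ) - Complex.ofRealHom.mapMatrix S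
          = - Complex.ofRealHom.mapMatrix (S - 1) := by
        rw [map_sub, map_one, map_one, neg_sub]
      rw [this, Matrix.det_neg, ← RingHom.map_det, h0]
      simp
    have := hS 1 h1
    norm_num at this
  refine ⟨hu, ?_⟩
  set C := (S + 1) * (S - 1)⁻¹ with hC
  have hCS : C * (S - 1) = S + 1 := by
    rw [hC, Matrix.mul_assoc, Matrix.nonsing_inv_mul _ hu, Matrix.mul_one]
  have hCS' : Complex.ofRealHom.mapMatrix C * (Complex.ofRealHom.mapMatrix S - 1)
      = Complex.ofRealHom.mapMatrix S + 1 := by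
    have := congrArg (Complex.ofRealHom.mapMatrix (m := n)) hCS
    simpa only [map_mul, map_sub, map_add, map_one] using this
  obtain ⟨k, hk⟩ := aux_gelfand (Complex.ofRealHom.mapMatrix C) (by
    intro c hc
    rw [Polynomial.IsRoot.def, Matrix.eval_charpoly] at hc
    have h1 : ((Matrix.scalar n c - Complex.ofRealHom.mapMatrix C) *
      (Complex.ofRealHom.mapMatrix S - 1)).det = 0 := by
      rw [Matrix.det_mul, hc, zero_mul]
    have h2 : (Matrix.scalar n c - Complex.ofRealHom.mapMatrix C) *
      (Complex.ofRealHom.mapMatrix S - 1) =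
        (c - 1) • Complex.ofRealHom.mapMatrix S - (c + 1) • (1 : Matrix n n ℂ) := by
      rw [sub_mul, hCS', Matrix.scalar_apply, ← Matrix.smul_one_eq_diagonal, smul_mul_assoc,
        one_mul]
      module
    rw [h2] at h1
    by_cases hc1 : c = 1
    · subst hc1
      rw [sub_self, zero_smul, zero_sub, Matrix.det_neg, Matrix.det_smul] at h1
      norm_num at h1
    have hc2 : c - 1 ≠ 0 := sub_ne_zero.mpr hc1
    have h3 := hS ((c + 1) / (c - 1)) (by
      rw [Polynomial.IsRoot.def, Matrix.eval_charpoly, hmap, Matrix.scalar_apply,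
        ← Matrix.smul_one_eq_diagonal]
      have h4 : (c - 1) • Complex.ofRealHom.mapMatrix S - (c + 1) • (1 : Matrix n n ℂ)
        = (-(c - 1)) • (((c + 1) / (c - 1)) • (1 : Matrix n n ℂ)
            - Complex.ofRealHom.mapMatrix S) := by
        rw [smul_sub, smul_smul, neg_mul, mul_div_cancel₀ _ hc2]
        module
      rw [h4, Matrix.det_smul] at h1
      exact (mul_eq_zero.mp h1).resolve_left (pow_ne_zero _ (neg_ne_zero.mpr hc2)))
    have h5 : ((c + 1) / (c - 1)).re = (Complex.normSq c - 1) / Complex.normSq (c - 1) := by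
      rw [Complex.div_re]
      simp [Complex.normSq_apply]
      ring
    rw [h5, div_neg_iff] at h3
    have h6 : 0 < Complex.normSq (c - 1) := Complex.normSq_pos.mpr hc2
    rcases h3 with h3 | h3
    · linarith [h3.2]
    · have h7 := h3.1
      rw [Complex.normSq_eq_norm_sq] at h7
      nlinarith [norm_nonneg c])
  refine ⟨k, fun x => aux_real_bound _ ?_ x⟩
  rw [hmap, map_pow]
  exact hk

lemma aux_dot_mul {m n : Type*} [Fintype m] [Fintype n] (M : Matrix m n ℝ) (x : n → ℝ)
    (y : m → ℝ) : x ⬝ᵥ (Mᵀ *ᵥ y) = (M *ᵥ x) ⬝ᵥ y := by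
  rw [Matrix.mulVec_transpose, dotProduct_comm, ← Matrix.dotProduct_mulVec, dotProduct_comm]

lemma aux_lyap {n : Type*} [Fintype n] [DecidableEq n] [Nonempty n] (A : Matrix n n ℝ) (δ : ℝ)
    (hA : specLt A (-δ)) :
    ∃ Q : Matrix n n ℝ, Qᵀ = Q ∧ (∀ x, x ≠ 0 → 0 < x ⬝ᵥ (Q *ᵥ x)) ∧ ∃ c : ℝ, 0 < c ∧
      ∀ x, 2 * ((Q *ᵥ x) ⬝ᵥ (A *ᵥ x)) + 2 * δ * (x ⬝ᵥ (Q *ᵥ x)) ≤ - c * (x ⬝ᵥ x) := by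
  set S : Matrix n n ℝ := A + δ • 1 with hSdef
  obtain ⟨hu, k, hk⟩ := aux_cayley S (by
    intro μ hμ
    have := hA (μ - δ) (by
      rw [Polynomial.IsRoot.def, Matrix.eval_charpoly] at hμ ⊢
      rw [← hμ]
      congr 1
      ext i j
      by_cases hij : i = j
      · subst hij; simp [hSdef]; ring
      · simp [hSdef, hij])
    simp at this
    linarith)
  set C := (S + 1) * (S - 1)⁻¹ with hC
  have hCS : C * (S - 1) = S + 1 := by
    rw [hC, Matrix.mul_assoc, Matrix.nonsing_inv_mul _ hu, Matrix.mul_one]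
  obtain ⟨c₁, hc₁, hT⟩ := aux_bound (S - 1)⁻¹
  set Q : Matrix n n ℝ := ∑ i ∈ Finset.range k, (C ^ i)ᵀ * C ^ i with hQ
  have hQT : Qᵀ = Q := by
    rw [hQ, Matrix.transpose_sum]
    simp
  have hf : ∀ y, y ⬝ᵥ (Q *ᵥ y) = ∑ i ∈ Finset.range k, (C ^ i *ᵥ y) ⬝ᵥ (C ^ i *ᵥ y) := by
    intro y
    rw [hQ, Matrix.sum_mulVec, dotProduct_sum]
    refine Finset.sum_congr rfl fun i _ => ?_
    rw [← Matrix.mulVec_mulVec, aux_dot_mul]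
  have hk0 : k ≠ 0 := by
    rintro rfl
    have h1 := hk 1
    have h2 : 0 < (1 : n → ℝ) ⬝ᵥ 1 := aux_dot_pos _ one_ne_zero
    rw [pow_zero, Matrix.one_mulVec] at h1
    linarith
  have hsymm : ∀ x y, x ⬝ᵥ (Q *ᵥ y) = (Q *ᵥ x) ⬝ᵥ y := by
    intro x y
    have := aux_dot_mul Q x y
    rwa [hQT] at this
  refine ⟨Q, hQT, fun x hx => ?_, 3 / 8 / (c₁ + 1), by positivity, fun x => ?_⟩
  · rw [hf]
    refine lt_of_lt_of_le (aux_dot_pos x hx) ?_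
    have := Finset.single_le_sum (f := fun i => (C ^ i *ᵥ x) ⬝ᵥ (C ^ i *ᵥ x))
      (fun i _ => aux_dot_nonneg _) (Finset.mem_range.mpr (Nat.pos_of_ne_zero hk0))
    simpa using this
  · set y := (S - 1) *ᵥ x with hy
    have hxy : x = (S - 1)⁻¹ *ᵥ y := by
      rw [hy, Matrix.mulVec_mulVec, Matrix.nonsing_inv_mul _ hu, Matrix.one_mulVec]
    have hCy : C *ᵥ y = (S + 1) *ᵥ x := by
      rw [hy, Matrix.mulVec_mulVec, hCS]
    have h1 : (C *ᵥ y) ⬝ᵥ (Q *ᵥ (C *ᵥ y)) - y ⬝ᵥ (Q *ᵥ y) =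
        (C ^ k *ᵥ y) ⬝ᵥ (C ^ k *ᵥ y) - y ⬝ᵥ y := by
      have h2 := Finset.sum_range_sub (fun i => (C ^ i *ᵥ y) ⬝ᵥ (C ^ i *ᵥ y)) k
      rw [hf, hf, ← Finset.sum_sub_distrib]
      simp only [Matrix.mulVec_mulVec, ← pow_succ]
      simpa using h2
    have h3 := hk y
    have h4 : x ⬝ᵥ x ≤ c₁ * (y ⬝ᵥ y) := by
      have := hT y
      rwa [← hxy] at this
    have h5 : (C *ᵥ y) ⬝ᵥ (Q *ᵥ (C *ᵥ y)) - y ⬝ᵥ (Q *ᵥ y) = 4 * ((Q *ᵥ x) ⬝ᵥ (S *ᵥ x)) := by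
      rw [hCy, hy, Matrix.add_mulVec, Matrix.sub_mulVec, Matrix.one_mulVec]
      simp only [Matrix.mulVec_add, Matrix.mulVec_sub, dotProduct_add, dotProduct_sub,
        add_dotProduct, sub_dotProduct]
      rw [hsymm x (S *ᵥ x), dotProduct_comm (S *ᵥ x) (Q *ᵥ x)]
      ring
    have h6 : (Q *ᵥ x) ⬝ᵥ (S *ᵥ x) = (Q *ᵥ x) ⬝ᵥ (A *ᵥ x) + δ * (x ⬝ᵥ (Q *ᵥ x)) := by
      rw [hSdef, Matrix.add_mulVec, Matrix.smul_mulVec, Matrix.one_mulVec, dotProduct_add,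
        dotProduct_smul, smul_eq_mul, dotProduct_comm x]
    have h7 : 3 / 8 / (c₁ + 1) * (x ⬝ᵥ x) ≤ 3 / 8 * (y ⬝ᵥ y) := by
      rw [div_mul_eq_mul_div, div_le_iff₀ (by positivity)]
      nlinarith [aux_dot_nonneg y]
    linarith

end Helpers

section Helpers2

lemma aux_theta {ι κ : Type*} [Fintype ι] [DecidableEq ι] [Fintype κ] [DecidableEq κ]
    (A Q G : Matrix ι ι ℝ) (B : Matrix ι (Fin 1) ℝ) (C : Matrix (Fin 1) κ ℝ) (D : Matrix κ ι ℝ)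
    (d : κ → ℝ) (δ c η s k β : ℝ) (hQT : Qᵀ = Q) (hQ : ∀ x, x ≠ 0 → 0 < x ⬝ᵥ (Q *ᵥ x))
    (hc : 0 < c)
    (hlyap : ∀ x, 2 * ((Q *ᵥ x) ⬝ᵥ (A *ᵥ x)) + 2 * δ * (x ⬝ᵥ (Q *ᵥ x)) ≤ - c * (x ⬝ᵥ x))
    (hη : 0 < η) (hd : ∀ i, d i + δ ≤ -η) (hGT : Gᵀ = G)
    (hG : ∀ x, s * (x ⬝ᵥ (G *ᵥ x)) ≤ c / 4 * (x ⬝ᵥ x))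
    (hk : 0 ≤ k) (hQk : ∀ x, (Q *ᵥ x) ⬝ᵥ (Q *ᵥ x) ≤ k * (x ⬝ᵥ x))
    (hβ : ∀ u, 4 * (k + 1) / c * ((B *ᵥ u) ⬝ᵥ (B *ᵥ u)) ≤ β * (u ⬝ᵥ u))
    (F Gm : Matrix (ι ⊕ (κ ⊕ κ)) (ι ⊕ (κ ⊕ κ)) ℝ) (Lm : Matrix (ι ⊕ (κ ⊕ κ)) (Fin 1) ℝ)
    (hF : F = fromBlocks A (fromCols 0 (B * C)) (fromRows D 0)
      (fromBlocks (diagonal d) 0 0 (diagonal d)))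
    (hGm : Gm = fromBlocks G 0 0 0) (hLm : Lm = fromRows B 0) :
    ∃ P : Matrix (ι ⊕ (κ ⊕ κ)) (ι ⊕ (κ ⊕ κ)) ℝ, P.IsSymm ∧ P.PosDef ∧
      (fromBlocks (Fᵀ * P + P * F + (2 * δ) • P + s • Gm) (P * Lm) (Lmᵀ * P)
        ((-β) • (1 : Matrix (Fin 1) (Fin 1) ℝ))).NegSemidef := by
  obtain ⟨dD, hdD, hD⟩ := aux_bound D
  obtain ⟨c1, hc1, hBC⟩ := aux_bound (B * C)
  set k' : ℝ := 4 * (k + 1) / c with hk'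
  have hk'0 : 0 < k' := by positivity
  set ρ : ℝ := c * η / (2 * (dD + 1)) with hρ
  set σ : ℝ := (k' * c1 + 1) / (2 * η) with hσ
  have hρ0 : 0 < ρ := by positivity
  have hσ0 : 0 < σ := by positivity
  set P : Matrix (ι ⊕ (κ ⊕ κ)) (ι ⊕ (κ ⊕ κ)) ℝ :=
    fromBlocks Q 0 0 (fromBlocks (ρ • 1) 0 0 (σ • 1)) with hP
  have hPT : Pᵀ = P := by
    rw [hP, fromBlocks_transpose, fromBlocks_transpose, hQT]
    simp
  have hPv : ∀ x z w, P *ᵥ (Sum.elim x (Sum.elim z w)) =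
      Sum.elim (Q *ᵥ x) (Sum.elim (ρ • z) (σ • w)) := by
    intro x z w
    rw [hP, fromBlocks_mulVec]
    simp only [Sum.elim_comp_inl, Sum.elim_comp_inr, fromBlocks_mulVec, zero_mulVec, add_zero,
      zero_add, smul_mulVec, one_mulVec]
  have hdecomp : ∀ v : ι ⊕ (κ ⊕ κ) → ℝ, ∃ x z w, v = Sum.elim x (Sum.elim z w) := by
    intro v
    refine ⟨v ∘ Sum.inl, v ∘ Sum.inr ∘ Sum.inl, v ∘ Sum.inr ∘ Sum.inr, ?_⟩
    ext i
    rcases i with i | i | i <;> rfl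
  have hFv : ∀ x z w, F *ᵥ (Sum.elim x (Sum.elim z w)) =
      Sum.elim (A *ᵥ x + (B * C) *ᵥ w)
        (Sum.elim (D *ᵥ x + (diagonal d) *ᵥ z) ((diagonal d) *ᵥ w)) := by
    intro x z w
    rw [hF, fromBlocks_mulVec]
    simp only [Sum.elim_comp_inl, Sum.elim_comp_inr, fromBlocks_mulVec, zero_mulVec, add_zero,
      zero_add, fromCols_mulVec, fromRows_mulVec]
    ext i
    rcases i with i | i | i <;> simp
  have hGv : ∀ x z w, Gm *ᵥ (Sum.elim x (Sum.elim z w)) = Sum.elim (G *ᵥ x) (Sum.elim 0 0) := by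
    intro x z w
    rw [hGm, fromBlocks_mulVec]
    simp only [Sum.elim_comp_inl, Sum.elim_comp_inr, zero_mulVec, add_zero]
    ext i
    rcases i with i | i | i <;> simp
  have hLv : ∀ u, Lm *ᵥ u = Sum.elim (B *ᵥ u) (Sum.elim 0 0) := by
    intro u
    rw [hLm, fromRows_mulVec]
    ext i
    rcases i with i | i | i <;> simp
  have hdz : ∀ z : κ → ℝ, z ⬝ᵥ ((diagonal d) *ᵥ z) + δ * (z ⬝ᵥ z) ≤ -η * (z ⬝ᵥ z) := by
    intro z
    simp only [dotProduct, mulVec_diagonal, Finset.mul_sum]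
    rw [← Finset.sum_add_distrib]
    refine Finset.sum_le_sum fun i _ => ?_
    nlinarith [hd i, mul_self_nonneg (z i)]
  refine ⟨P, hPT, ?_, ?_⟩
  · refine PosDef.of_dotProduct_mulVec_pos ?_ ?_
    · rw [IsHermitian, conjTranspose_eq_transpose_of_trivial, hPT]
    · intro v hv
      obtain ⟨x, z, w, rfl⟩ := hdecomp v
      rw [star_trivial, hPv]
      simp only [sumElim_dotProduct_sumElim, dotProduct_smul, smul_eq_mul]
      have hz := mul_nonneg hρ0.le (aux_dot_nonneg z)
      have hw := mul_nonneg hσ0.le (aux_dot_nonneg w)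
      by_cases hx0 : x = 0
      · by_cases hz0 : z = 0
        · have hw0 : w ≠ 0 := by
            rintro rfl
            apply hv
            subst hx0 hz0
            ext i
            rcases i with i | i | i <;> rfl
          have := mul_pos hσ0 (aux_dot_pos w hw0)
          subst hx0
          simp only [zero_dotProduct]
          linarith
        · have := mul_pos hρ0 (aux_dot_pos z hz0)
          subst hx0
          simp only [zero_dotProduct]
          linarith
      · have := hQ x hx0
        linarith
  · have hGmT : Gmᵀ = Gm := by
      rw [hGm, fromBlocks_transpose, hGT]
      simp
    refine PosSemidef.of_dotProduct_mulVec_nonneg ?_ ?_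
    · rw [IsHermitian, conjTranspose_eq_transpose_of_trivial, transpose_neg, fromBlocks_transpose]
      simp only [transpose_add, transpose_mul, transpose_transpose, transpose_smul, hPT, hGmT,
        transpose_one]
      rw [add_comm (P * F)]
    · intro v
      obtain ⟨X, u, rfl⟩ : ∃ X u, v = Sum.elim X u :=
        ⟨v ∘ Sum.inl, v ∘ Sum.inr, (Sum.elim_comp_inl_inr v).symm⟩
      rw [star_trivial, neg_mulVec, dotProduct_neg, neg_nonneg, fromBlocks_mulVec]
      simp only [Sum.elim_comp_inl, Sum.elim_comp_inr, sumElim_dotProduct_sumElim, add_mulVec,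
        dotProduct_add, smul_mulVec, one_mulVec, dotProduct_smul, smul_eq_mul, ← mulVec_mulVec,
        aux_dot_mul]
      have hPs : ∀ a b, a ⬝ᵥ (P *ᵥ b) = (P *ᵥ a) ⬝ᵥ b := by
        intro a b
        have := aux_dot_mul P a b
        rwa [hPT] at this
      rw [hPs X (F *ᵥ X), hPs X (Lm *ᵥ u), dotProduct_comm (F *ᵥ X), dotProduct_comm (Lm *ᵥ u)]
      obtain ⟨x, z, w, rfl⟩ := hdecomp X
      rw [hPv, hFv, hLv, hGv]
      simp only [sumElim_dotProduct_sumElim, dotProduct_zero, add_zero, dotProduct_add,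
        smul_dotProduct, dotProduct_smul, smul_eq_mul]
      have e1 := hlyap x
      have e2 := hG x
      have he : 0 < c / (4 * (k + 1)) := by positivity
      have hinv : (c / (4 * (k + 1)))⁻¹ = k' := by rw [inv_div]
      have hkk : c / (4 * (k + 1)) * ((Q *ᵥ x) ⬝ᵥ (Q *ᵥ x)) ≤ c / 4 * (x ⬝ᵥ x) := by
        have h1 := hQk x
        have h2 : (Q *ᵥ x) ⬝ᵥ (Q *ᵥ x) ≤ (k + 1) * (x ⬝ᵥ x) := by
          linarith [aux_dot_nonneg x]
        calc _ ≤ c / (4 * (k + 1)) * ((k + 1) * (x ⬝ᵥ x)) :=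
              mul_le_mul_of_nonneg_left h2 he.le
          _ = _ := by field_simp
      have e3 := aux_young (Q *ᵥ x) ((B * C) *ᵥ w) _ he
      have e4 := aux_young (Q *ᵥ x) (B *ᵥ u) _ he
      rw [hinv] at e3 e4
      have e5 := hβ u
      have e6 := mul_le_mul_of_nonneg_left (hBC w) hk'0.le
      have e7 := mul_le_mul_of_nonneg_left (hdz z) hρ0.le
      have e8 := mul_le_mul_of_nonneg_left (hdz w) hσ0.le
      have e9 := mul_le_mul_of_nonneg_left
        (aux_young z (D *ᵥ x) (2 * η) (by positivity)) hρ0.le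
      have e10 : ρ * ((2 * η)⁻¹ * ((D *ᵥ x) ⬝ᵥ (D *ᵥ x))) ≤ c / 4 * (x ⬝ᵥ x) := by
        have h2 : (D *ᵥ x) ⬝ᵥ (D *ᵥ x) ≤ (dD + 1) * (x ⬝ᵥ x) := by
          linarith [aux_dot_nonneg x, hD x]
        calc _ ≤ ρ * ((2 * η)⁻¹ * ((dD + 1) * (x ⬝ᵥ x))) := by gcongr
          _ = _ := by
            rw [hρ]
            field_simp
            ring
      have e11 : k' * (c1 * (w ⬝ᵥ w)) ≤ 2 * σ * η * (w ⬝ᵥ w) := by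
        have : 2 * σ * η = k' * c1 + 1 := by
          rw [hσ]
          field_simp
        rw [this]
        linarith [aux_dot_nonneg w]
      linarith

lemma aux_rpow (t : ℝ) (ht : 0 ≤ t) (β γ M r : ℝ) (hγ : 0 < γ) (hβM : 0 ≤ β * M)
    (h1 : (2 * (β * M) / γ) ^ 4 ≤ t) (h2 : 4 * r ≤ t) (h3 : 0 < t) :
    2 * γ * (-(1 - 1 / 2) * t + r) + β * M * t ^ (1 / 2 + 1 / 4 : ℝ) ≤ 0 ∧
    2 * γ * (1 - 1 / 2) - β * M / t ^ (1 / 2 - 1 / 4 : ℝ) ≥ 0 := by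
  set q : ℝ := t ^ (1 / 4 : ℝ) with hq
  have hq0 : 0 < q := Real.rpow_pos_of_pos h3 _
  have hq4 : q ^ 4 = t := by
    rw [hq, ← Real.rpow_natCast, ← Real.rpow_mul ht]
    norm_num
  have hq3 : t ^ (1 / 2 + 1 / 4 : ℝ) = q ^ 3 := by
    rw [hq, ← Real.rpow_natCast, ← Real.rpow_mul ht]
    norm_num
  have hq1 : t ^ (1 / 2 - 1 / 4 : ℝ) = q := by
    rw [hq]
    norm_num
  rw [hq3, hq1]
  have h5 : 2 * (β * M) / γ ≤ q := by
    rw [← hq4] at h1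
    exact le_of_pow_le_pow_left₀ (by norm_num) hq0.le h1
  rw [div_le_iff₀ hγ] at h5
  constructor
  · have h6 := mul_le_mul_of_nonneg_right h5 (show 0 ≤ q ^ 3 by positivity)
    have h7 : q * γ * q ^ 3 = γ * t := by rw [← hq4]; ring
    rw [h7] at h6
    have h8 := mul_le_mul_of_nonneg_left h2 hγ.le
    linarith
  · have : β * M / q ≤ γ := by
      rw [div_le_iff₀ hq0]
      linarith
    linarith

end Helpers2

/-- Feasibility of the LMI constraints of Theorem 3 (Neumann
boundary measurement): there exist `N ≥ N₀+1`, a symmetric positive definite `P`,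
and reals `ε ∈ (0,1/2]`, `α > 1`, `β, γ > 0` such that `Θ₁ ⪯ 0`, `Θ₂ ≤ 0` and
`Θ₃ ≥ 0`, where `Θ₂`, `Θ₃` are built from `M₂(ε) = ∑_{n≥2} y_n²/λ_n^{3/2+ε}`. -/
theorem lmi_feasibility_neumann_measurement
    (N₀ : ℕ) (hN₀ : 1 ≤ N₀) (δ qc pstar : ℝ) (hδ : 0 < δ) (hpstar : 0 < pstar)
    (lam a b y : ℕ → ℝ)
    (hmono : ∀ n, 1 ≤ n → lam n ≤ lam (n + 1))
    (hnonneg : ∀ n, 1 ≤ n → 0 ≤ lam n)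
    (hlow : ∀ n : ℕ, 1 ≤ n → Real.pi ^ 2 * ((n : ℝ) - 1) ^ 2 * pstar ≤ lam n)
    (hgap : ∀ n, N₀ + 1 ≤ n → -lam n + qc < -δ)
    (ha : Summable fun n : ℕ => a (n + 1) ^ 2)
    (hb : Summable fun n : ℕ => b (n + 1) ^ 2)
    (cphi : ℝ) (hcphi : 0 < cphi)
    (hy : ∀ n : ℕ, 2 ≤ n → y n ^ 2 ≤ cphi * lam n)
    (K : Matrix (Fin 1) (Fin 1 ⊕ Fin N₀) ℝ) (L : Matrix (Fin N₀) (Fin 1) ℝ)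
    (hK : specLt (A1 N₀ lam qc a + B1 N₀ b * K) (-δ))
    (hL : specLt (A0 N₀ lam qc - L * C0 N₀ y) (-δ)) :
    ∃ N : ℕ, N₀ + 1 ≤ N ∧
      ∃ P : Matrix (ιF N₀ N) (ιF N₀ N) ℝ, P.IsSymm ∧ P.PosDef ∧
        ∃ ε α β γ : ℝ, 0 < ε ∧ ε ≤ 1 / 2 ∧ 1 < α ∧ 0 < β ∧ 0 < γ ∧
          (Matrix.fromBlocks
            ((Fmat N₀ N lam a b qc K L (C0 N₀ y) (C1 N₀ N lam y))ᵀ * P +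
              P * Fmat N₀ N lam a b qc K L (C0 N₀ y) (C1 N₀ N lam y) + (2 * δ) • P +
              (α * γ) • Gmat N₀ N (∑' n : ℕ, a (n + 1) ^ 2) (∑' n : ℕ, b (n + 1) ^ 2) K)
            (P * Lcal N₀ N L) ((Lcal N₀ N L)ᵀ * P)
            ((-β) • (1 : Matrix (Fin 1) (Fin 1) ℝ))).NegSemidef ∧
          2 * γ * (-(1 - 1 / α) * lam (N + 1) + qc + δ)
            + β * (∑' n : ℕ, y (n + 2) ^ 2 / lam (n + 2) ^ (3 / 2 + ε : ℝ))
                * lam (N + 1) ^ (1 / 2 + ε : ℝ) ≤ 0 ∧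
          2 * γ * (1 - 1 / α)
            - β * (∑' n : ℕ, y (n + 2) ^ 2 / lam (n + 2) ^ (3 / 2 + ε : ℝ))
                / lam (N + 1) ^ (1 / 2 - ε : ℝ) ≥ 0 := by
  set A : Matrix ((Fin 1 ⊕ Fin N₀) ⊕ Fin N₀) ((Fin 1 ⊕ Fin N₀) ⊕ Fin N₀) ℝ :=
    Matrix.fromBlocks (A1 N₀ lam qc a + B1 N₀ b * K) (Ltil N₀ L * C0 N₀ y)
      0 (A0 N₀ lam qc - L * C0 N₀ y) with hA
  have hspec : specLt A (-δ) := by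
    intro μ hμ
    rw [hA, Matrix.fromBlocks_map, Matrix.map_zero _ Complex.ofReal_zero,
      Matrix.charpoly_fromBlocks_zero₂₁, Polynomial.IsRoot.def, Polynomial.eval_mul] at hμ
    rcases mul_eq_zero.mp hμ with h | h
    · exact hK μ h
    · exact hL μ h
  obtain ⟨Q, hQT, hQ, c, hc, hlyap⟩ := aux_lyap A δ hspec
  set B : Matrix ((Fin 1 ⊕ Fin N₀) ⊕ Fin N₀) (Fin 1) ℝ := fromRows (Ltil N₀ L) (-L) with hB
  obtain ⟨k, hk, hQk⟩ := aux_bound Q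
  obtain ⟨cB, hcB, hBb⟩ := aux_bound B
  set E₀ : Matrix (Fin 1) ((Fin 1 ⊕ Fin N₀) ⊕ Fin N₀) ℝ :=
    fromCols (fromCols 1 0) 0 with hE
  set K₀ : Matrix (Fin 1) ((Fin 1 ⊕ Fin N₀) ⊕ Fin N₀) ℝ := fromCols K 0 with hK₀
  obtain ⟨cE, hcE, hEb⟩ := aux_bound E₀
  obtain ⟨cK, hcK, hKb⟩ := aux_bound K₀
  set na := ∑' n : ℕ, a (n + 1) ^ 2 with hna
  set nb := ∑' n : ℕ, b (n + 1) ^ 2 with hnb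
  have hna0 : 0 ≤ na := tsum_nonneg fun n => sq_nonneg _
  have hnb0 : 0 ≤ nb := tsum_nonneg fun n => sq_nonneg _
  set G : Matrix ((Fin 1 ⊕ Fin N₀) ⊕ Fin N₀) ((Fin 1 ⊕ Fin N₀) ⊕ Fin N₀) ℝ :=
    na • (E₀ᵀ * E₀) + nb • (K₀ᵀ * K₀) with hG
  set g := na * cE + nb * cK with hg
  have hg0 : 0 ≤ g := by positivity
  have hGb : ∀ x, x ⬝ᵥ (G *ᵥ x) ≤ g * (x ⬝ᵥ x) := by
    intro x
    rw [hG]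
    simp only [add_mulVec, dotProduct_add, smul_mulVec, dotProduct_smul, smul_eq_mul,
      ← mulVec_mulVec, aux_dot_mul]
    have h1 := mul_le_mul_of_nonneg_left (hEb x) hna0
    have h2 := mul_le_mul_of_nonneg_left (hKb x) hnb0
    rw [hg]
    linarith
  set γ : ℝ := c / (8 * (g + 1)) with hγ
  have hγ0 : 0 < γ := by positivity
  set β : ℝ := 4 * (k + 1) / c * cB + 1 with hβ
  have hβ0 : 0 < β := by positivity
  set M := ∑' n : ℕ, y (n + 2) ^ 2 / lam (n + 2) ^ (3 / 2 + 1 / 4 : ℝ) with hM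
  have hM0 : 0 ≤ M := tsum_nonneg fun n =>
    div_nonneg (sq_nonneg _) (Real.rpow_nonneg (hnonneg _ (by omega)) _)
  -- choice of N
  have hmono' : ∀ m, N₀ + 1 ≤ m → lam (N₀ + 1) ≤ lam m := by
    intro m hm
    induction m, hm using Nat.le_induction with
    | base => exact le_rfl
    | succ m hm ih => exact ih.trans (hmono m (by omega))
  obtain ⟨N, hN, hN1, hN2, hN3⟩ : ∃ N : ℕ, N₀ + 1 ≤ N ∧
      (2 * (β * M) / γ) ^ 4 ≤ lam (N + 1) ∧ 4 * (qc + δ) ≤ lam (N + 1) ∧ 0 < lam (N + 1) := by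
    obtain ⟨m, hm⟩ := exists_nat_ge
      ((|(2 * (β * M) / γ) ^ 4| + |4 * (qc + δ)| + 1) / (Real.pi ^ 2 * pstar))
    have hpp : 0 < Real.pi ^ 2 * pstar := by positivity
    rw [div_le_iff₀ hpp] at hm
    refine ⟨N₀ + 1 + m, by omega, ?_⟩
    have h1 := hlow (N₀ + 1 + m + 1) (by omega)
    have h2 : (m : ℝ) ≤ (((N₀ + 1 + m + 1 : ℕ) : ℝ) - 1) ^ 2 := by
      push_cast
      have : (0 : ℝ) ≤ N₀ := Nat.cast_nonneg _
      have : (0 : ℝ) ≤ m := Nat.cast_nonneg _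
      nlinarith
    have h3 := mul_le_mul_of_nonneg_right h2 hpp.le
    have h4 := le_abs_self ((2 * (β * M) / γ) ^ 4)
    have h5 := le_abs_self (4 * (qc + δ))
    have h6 := abs_nonneg ((2 * (β * M) / γ) ^ 4)
    have h7 := abs_nonneg (4 * (qc + δ))
    refine ⟨?_, ?_, ?_⟩ <;> nlinarith
  have hη : 0 < lam (N₀ + 1) - qc - δ := by
    have := hgap (N₀ + 1) le_rfl
    linarith
  obtain ⟨P, hP1, hP2, hP3⟩ := aux_theta A Q G B (C1 N₀ N lam y)
    (fromCols (colVec2 N₀ N b * K + B2a0 N₀ N a) 0)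
    (fun i : Fin (N - N₀) => -lam (N₀ + 1 + i.1) + qc) δ c (lam (N₀ + 1) - qc - δ) (2 * γ) k β
    hQT hQ hc hlyap hη
    (fun i => by
      have := hmono' (N₀ + 1 + i.1) (by omega)
      linarith)
    (by
      rw [hG]
      simp)
    (fun x => by
      have h1 := mul_le_mul_of_nonneg_left (hGb x) (show 0 ≤ 2 * γ by positivity)
      refine h1.trans ?_
      have h2 : 2 * γ * ((g + 1) * (x ⬝ᵥ x)) = c / 4 * (x ⬝ᵥ x) := by
        rw [hγ]
        field_simp
        ring
      rw [← h2]
      have := aux_dot_nonneg x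
      gcongr
      linarith)
    hk hQk
    (fun u => by
      have h1 := mul_le_mul_of_nonneg_left (hBb u) (show 0 ≤ 4 * (k + 1) / c by positivity)
      have := aux_dot_nonneg u
      rw [hβ]
      linarith)
    (Fmat N₀ N lam a b qc K L (C0 N₀ y) (C1 N₀ N lam y)) (Gmat N₀ N na nb K) (Lcal N₀ N L)
    (by
      rw [Fmat, ← hA]
      congr 1
      · ext i j
        rcases i with i | i <;> rcases j with j | j <;>
          simp [hB, fromRows_mul, Matrix.neg_mul]
      · ext i j
        rcases i with i | i <;> rcases j with j | j <;> simp)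
    (by
      rw [Gmat, hG]
      ext i j
      rcases i with ((i | i) | i) | (i | i) <;> rcases j with ((j | j) | j) | (j | j) <;>
        simp [Matrix.mul_apply, Erow, Ktil, hE, hK₀, Matrix.one_apply, Fin.fin_one_eq_zero])
    (by
      ext i j
      rcases i with ((i | i) | i) | (i | i) <;> simp [Lcal, hB])
  obtain ⟨hT2, hT3⟩ := aux_rpow (lam (N + 1)) hN3.le β γ M (qc + δ) hγ0 (by positivity)
    hN1 hN2 hN3
  refine ⟨N, hN, P, hP1, hP2, 1 / 4, 2, β, γ, by norm_num, by norm_num, by norm_num, hβ0, hγ0,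
    hP3, ?_, hT3⟩
  rw [add_assoc (-(1 - 1 / 2) * lam (N + 1))]
  exact hT2

end
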